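/- arXiv:2510.03554 — 2 statements merged into one kernel-verified Lean document; each statement's English description precedes it below -/
import Mathlib

section
/- Let k ≥ 2 be an integer and let G be a finite simple graph with a perfect matching. Let X be a vertex cut of G with |X| = 2k−1 such that a maximum matching M(X) of the induced subgraph G[X] has size k−1, and let x be the unique vertex of X not covered by M(X). Let H_1 and H_2 be two distinct connected components of G − X. If x has a neighbor in H_1 and a neighbor in H_2, then G is not k-extendable. -/
open SimpleGraph

/-- A graph `G` is `k`-extendable if it is connected, has a perfect matching, and every
matching of size `k` is contained in a perfect matching. -/
def KExt {V : Type*} [Fintype V] (G : SimpleGraph V) (k : ℕ) : Prop :=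
  G.Connected ∧ (∃ P : G.Subgraph, P.IsPerfectMatching) ∧
    ∀ M : G.Subgraph, M.IsMatching → M.edgeSet.ncard = k →
      ∃ P : G.Subgraph, P.IsPerfectMatching ∧ M ≤ P

/-- `X` is a vertex cut of `G`: deleting the vertices of `X` leaves a disconnected graph. -/
def IsVertexCut {V : Type*} (G : SimpleGraph V) (X : Set V) : Prop :=
  ¬ (G.induce Xᶜ).Preconnected

namespace SimpleGraph.Subgraph

variable {V : Type*} {G : SimpleGraph V} {M P : G.Subgraph}

theorem IsMatching.ncard_verts [Finite V] (h : M.IsMatching) :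
    M.verts.ncard = 2 * M.edgeSet.ncard := by
  classical
  have := Fintype.ofFinite V
  have hE : M.edgeSet.ncard = M.coe.edgeFinset.card := by
    rw [← image_coe_edgeSet_coe, Set.ncard_image_of_injective _
      (Sym2.map.injective Subtype.val_injective), Set.ncard_eq_toFinset_card', edgeFinset]
  rw [isMatching_iff_forall_degree] at h
  rw [hE, ← M.coe.sum_degrees_eq_twice_card_edges]
  rw [Finset.sum_congr rfl (g := fun _ ↦ 1) fun v _ ↦ by
    rw [← h v v.2, ← coe_degree]; congr!]
  simp [Set.ncard_eq_toFinset_card', Set.toFinset_card]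

/-- A set of vertices closed under taking partners in a perfect matching has even size. -/
theorem IsPerfectMatching.even_ncard_of_closed [Finite V] (hP : P.IsPerfectMatching) {S : Set V}
    (hS : ∀ v ∈ S, ∀ w, P.Adj v w → w ∈ S) : Even S.ncard := by
  have hm : (P.induce S).IsMatching := by
    intro v hv
    obtain ⟨w, hw, hu⟩ := hP.1 (hP.2 v)
    exact ⟨w, ⟨hv, hS v hv w hw, hw⟩, fun z hz ↦ hu z hz.2.2⟩
  have h := hm.ncard_verts
  rw [induce_verts] at h
  exact h ▸ even_two_mul _

end SimpleGraph.Subgraph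

/-- Let `M` be a matching of size `k - 1` covering all of `X` except `x`, and let `y ∉ X` be a
neighbor of `x`. In a `k`-extendable graph, every component of `G - X` becomes even once `y` is
removed from it. -/
theorem KExt.even_ncard_component_diff {V : Type*} [Fintype V] {G : SimpleGraph V} {k : ℕ}
    (hG : KExt G k) (hk : 1 ≤ k) {X : Set V} {M : G.Subgraph} (hM : M.IsMatching)
    (hMk : M.edgeSet.ncard = k - 1) {x y : V} (hX : X = insert x M.verts) (hx : x ∉ M.verts)
    (hy : y ∉ X) (hxy : G.Adj x y) (C : (G.induce Xᶜ).ConnectedComponent) :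
    Even ((Subtype.val '' C.supp) \ {y}).ncard := by
  have hyM : y ∉ M.verts := fun h ↦ hy (hX ▸ Set.mem_insert_of_mem _ h)
  have hdisj : Disjoint M.support (G.subgraphOfAdj hxy).support := by
    rw [hM.support_eq_verts, (Subgraph.IsMatching.subgraphOfAdj hxy).support_eq_verts]
    simp [hx, hyM]
  have hcard : (M ⊔ G.subgraphOfAdj hxy).edgeSet.ncard = k := by
    rw [Subgraph.edgeSet_sup, edgeSet_subgraphOfAdj, Set.union_singleton,
      Set.ncard_insert_of_notMem (fun h ↦ hx (M.edge_vert (Subgraph.mem_edgeSet.1 h))), hMk]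
    omega
  obtain ⟨P, hP, hle⟩ := hG.2.2 _ (hM.sup (.subgraphOfAdj hxy) hdisj) hcard
  have hPxy : P.Adj x y := hle.2 (Or.inr (by simp))
  refine hP.even_ncard_of_closed ?_
  rintro _ ⟨⟨⟨v, hv⟩, hvC, rfl⟩, hvy⟩ w hvw
  have hwX : w ∉ X := by
    intro hw
    rcases hX ▸ hw with rfl | hw
    · exact hvy (hP.1.eq_of_adj_left hvw.symm hPxy)
    · obtain ⟨u, hu, -⟩ := hM hw
      have : v = u := hP.1.eq_of_adj_left hvw.symm (hle.2 (Or.inl hu))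
      exact hv (hX ▸ Set.mem_insert_of_mem _ (this ▸ M.edge_vert hu.symm))
  refine ⟨⟨⟨w, hwX⟩, ?_, rfl⟩, ?_⟩
  · have hadj : (G.induce Xᶜ).Adj ⟨v, hv⟩ ⟨w, hwX⟩ := hvw.adj_sub
    exact (ConnectedComponent.connectedComponentMk_eq_of_adj hadj).symm.trans hvC
  · rintro rfl
    have hxv : x = v := hP.1.eq_of_adj_right hPxy hvw
    exact hv (hX ▸ hxv ▸ Set.mem_insert _ _)

theorem stmt10 {V : Type*} [Fintype V] (G : SimpleGraph V) (k : ℕ) (hk : 2 ≤ k)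
    (hpm : ∃ P : G.Subgraph, P.IsPerfectMatching)
    (X : Set V) (hcut : IsVertexCut G X) (hX : X.ncard = 2 * k - 1)
    (M : G.Subgraph) (hM : M.IsMatching) (hMX : M.verts ⊆ X)
    (hmax : ∀ M' : G.Subgraph, M'.IsMatching → M'.verts ⊆ X →
      M'.edgeSet.ncard ≤ M.edgeSet.ncard)
    (hMk : M.edgeSet.ncard = k - 1)
    (x : V) (hxX : x ∈ X) (hxM : x ∉ M.verts)
    (C₁ C₂ : (G.induce Xᶜ).ConnectedComponent) (hC : C₁ ≠ C₂)
    (h₁ : ∃ y, ∃ (hy : y ∈ Xᶜ), G.Adj x y ∧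
      (G.induce Xᶜ).connectedComponentMk ⟨y, hy⟩ = C₁)
    (h₂ : ∃ y, ∃ (hy : y ∈ Xᶜ), G.Adj x y ∧
      (G.induce Xᶜ).connectedComponentMk ⟨y, hy⟩ = C₂) :
    ¬ KExt G k := by
  intro hG
  obtain ⟨y₁, hy₁, hxy₁, rfl⟩ := h₁
  obtain ⟨y₂, hy₂, hxy₂, rfl⟩ := h₂
  have hXM : X = insert x M.verts := by
    refine (Set.eq_of_subset_of_ncard_le (Set.insert_subset hxX hMX) ?_).symm
    rw [Set.ncard_insert_of_notMem hxM, hM.ncard_verts]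
    omega
  set C := (G.induce Xᶜ).connectedComponentMk ⟨y₁, hy₁⟩
  have e₁ := hG.even_ncard_component_diff (by omega) hM hMk hXM hxM hy₁ hxy₁ C
  have e₂ := hG.even_ncard_component_diff (by omega) hM hMk hXM hxM hy₂ hxy₂ C
  have hmem : y₁ ∈ Subtype.val '' C.supp := ⟨⟨y₁, hy₁⟩, rfl, rfl⟩
  have hnot : y₂ ∉ Subtype.val '' C.supp := by
    rintro ⟨⟨z, hz⟩, hzC, rfl⟩
    exact hC (Eq.symm hzC)
  rw [Set.sdiff_singleton_eq_self hnot, ← Set.ncard_sdiff_singleton_add_one hmem] at e₂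
  exact (Nat.even_add_one.1 e₂) e₁
end

section
/- Let G be a finite simple minimal k-extendable graph (k ≥ 1), let e = uv be an edge of G, and let S_e ⊆ V(G)∖{u,v} be a set such that: G[S_e] has a matching of size at least k; the number of odd components of G_e := G − e − S_e equals |S_e| − 2k + 2; and u and v belong to two distinct odd components of G_e. Let M be a matching of G[S_e] with |M| = k. If |S_e| ≥ 2k+1, then every vertex of S_e not covered by M has a neighbor in some odd component of G_e other than the odd components containing u and v. -/
open SimpleGraph

/-- A `k`-extendable graph is minimal if deleting any edge destroys `k`-extendability. -/
def MinimalKExt {V : Type*} [Fintype V] (G : SimpleGraph V) (k : ℕ) : Prop :=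
  KExt G k ∧ ∀ e ∈ G.edgeSet, ¬ KExt (G.deleteEdges {e}) k

/-- The graph `G - e - S` obtained from `G` by deleting the edge `e = uv` and the vertices
of `S`. -/
def Ge {V : Type*} (G : SimpleGraph V) (u v : V) (S : Set V) : SimpleGraph ↑(Sᶜ) :=
  (G.deleteEdges {s(u, v)}).induce Sᶜ

/-- `S` is an admissible set for the edge `uv` (with parameter `k`): `S ⊆ V ∖ {u, v}`,
`G[S]` has a matching of size at least `k`, the number of odd components of `G - uv - S`
equals `|S| - 2k + 2`, and `u`, `v` lie in two distinct odd components of `G - uv - S`. -/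
def Admissible {V : Type*} [Fintype V] (G : SimpleGraph V) (k : ℕ) (u v : V) (S : Set V) :
    Prop :=
  u ∉ S ∧ v ∉ S ∧
  (∃ M : G.Subgraph, M.IsMatching ∧ M.verts ⊆ S ∧ k ≤ M.edgeSet.ncard) ∧
  Set.ncard {C : (Ge G u v S).ConnectedComponent | Odd C.supp.ncard} + 2 * k = S.ncard + 2 ∧
  ∃ (hu : u ∈ Sᶜ) (hv : v ∈ Sᶜ),
    (Ge G u v S).connectedComponentMk ⟨u, hu⟩ ≠ (Ge G u v S).connectedComponentMk ⟨v, hv⟩ ∧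
    Odd ((Ge G u v S).connectedComponentMk ⟨u, hu⟩).supp.ncard ∧
    Odd ((Ge G u v S).connectedComponentMk ⟨v, hv⟩).supp.ncard

/-- A matching covers exactly twice as many vertices as it has edges. -/
lemma SimpleGraph.Subgraph.IsMatching.ncard_verts_s14 {V : Type*} [Finite V] {G : SimpleGraph V}
    {M : G.Subgraph} (hM : M.IsMatching) : M.verts.ncard = 2 * M.edgeSet.ncard := by
  classical
  have := Fintype.ofFinite V
  have hdeg (x : V) : M.spanningCoe.degree x = if x ∈ M.verts then 1 else 0 := by
    rw [Subgraph.degree_spanningCoe]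
    split_ifs with hx
    · exact Subgraph.degree_eq_one_iff_existsUnique_adj.2 (hM hx)
    · exact Subgraph.degree_of_notMem_verts hx
  have hsum := M.spanningCoe.sum_degrees_eq_twice_card_edges
  simp_rw [hdeg] at hsum
  rw [← Subgraph.edgeSet_spanningCoe, ← coe_edgeFinset, Set.ncard_coe_finset, ← hsum,
    Set.ncard_eq_toFinset_card', Finset.sum_boole, Nat.cast_id]
  congr 1
  ext
  simp

/-- A perfect matching of `G` joins every odd component of `G - uv - S` that avoids both `u`
and `v` to a vertex of `S`. -/
lemma exists_adj_of_odd_component {V : Type*} [Finite V] {G : SimpleGraph V} {u v : V}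
    {S : Set V} {P : G.Subgraph} (hP : P.IsPerfectMatching) (hu : u ∈ Sᶜ) (hv : v ∈ Sᶜ)
    {C : (Ge G u v S).ConnectedComponent} (hodd : Odd C.supp.ncard)
    (hCu : C ≠ (Ge G u v S).connectedComponentMk ⟨u, hu⟩)
    (hCv : C ≠ (Ge G u v S).connectedComponentMk ⟨v, hv⟩) :
    ∃ w ∈ S, ∃ x ∈ C.supp, P.Adj w x := by
  by_contra! h
  have hmatch : (P.induce (Subtype.val '' C.supp)).IsMatching := by
    rintro _ ⟨x, hx, rfl⟩
    obtain ⟨y, hxy, huniq⟩ := hP.1 (hP.2 x)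
    have hyS : y ∈ Sᶜ := fun hy ↦ h y hy x hx hxy.symm
    have hxu : (x : V) ≠ u := by rintro rfl; exact hCu hx.symm
    have hxv : (x : V) ≠ v := by rintro rfl; exact hCv hx.symm
    have hadj : (Ge G u v S).Adj ⟨y, hyS⟩ x := by
      simp [Ge, hxu, hxv, hxy.symm.adj_sub]
    have hyC : (⟨y, hyS⟩ : ↥Sᶜ) ∈ C.supp :=
      (ConnectedComponent.sound hadj.reachable).trans hx
    exact ⟨y, ⟨⟨x, hx, rfl⟩, ⟨_, hyC, rfl⟩, hxy⟩, fun z hz ↦ huniq z hz.2.2⟩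
  have hcard := hmatch.ncard_verts_s14
  rw [Subgraph.induce_verts, Set.ncard_image_of_injective _ Subtype.val_injective] at hcard
  rw [hcard] at hodd
  exact Nat.not_odd_iff_even.2 (even_two_mul _) hodd

theorem stmt14 {V : Type*} [Fintype V] (G : SimpleGraph V) (k : ℕ) (hk : 1 ≤ k)
    (hmin : MinimalKExt G k) (u v : V) (huv : G.Adj u v)
    (S : Set V) (hS : Admissible G k u v S)
    (M : G.Subgraph) (hM : M.IsMatching) (hMS : M.verts ⊆ S)
    (hMk : M.edgeSet.ncard = k)
    (hScard : 2 * k + 1 ≤ S.ncard) :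
    ∀ w ∈ S, w ∉ M.verts →
      ∀ (hu : u ∈ Sᶜ) (hv : v ∈ Sᶜ),
        ∃ y, ∃ (hy : y ∈ Sᶜ), G.Adj w y ∧
          Odd ((Ge G u v S).connectedComponentMk ⟨y, hy⟩).supp.ncard ∧
          (Ge G u v S).connectedComponentMk ⟨y, hy⟩ ≠
            (Ge G u v S).connectedComponentMk ⟨u, hu⟩ ∧
          (Ge G u v S).connectedComponentMk ⟨y, hy⟩ ≠
            (Ge G u v S).connectedComponentMk ⟨v, hv⟩ := by
  obtain ⟨-, -, -, hcard, hu, hv, hne, hoddu, hoddv⟩ := hS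
  intro w hwS hwM _ _
  obtain ⟨P, hP, hMP⟩ := hmin.1.2.2 M hM hMk
  set Cu := (Ge G u v S).connectedComponentMk ⟨u, hu⟩
  set Cv := (Ge G u v S).connectedComponentMk ⟨v, hv⟩
  set O := {C : (Ge G u v S).ConnectedComponent | Odd C.supp.ncard}
  have key : ∀ C ∈ O \ {Cu, Cv}, ∃ w ∈ S, ∃ x ∈ C.supp, P.Adj w x := by
    rintro C ⟨hodd, hC⟩
    rw [Set.mem_insert_iff, Set.mem_singleton_iff, not_or] at hC
    exact exists_adj_of_odd_component hP hu hv hodd hC.1 hC.2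
  choose f hfS x hx hadj using key
  have hfM (C) (hC : C ∈ O \ {Cu, Cv}) : f C hC ∈ S \ M.verts := by
    refine ⟨hfS C hC, fun hmem ↦ ?_⟩
    obtain ⟨y, hy, -⟩ := hM hmem
    exact (x C hC).2 (hP.1.eq_of_adj_left (hMP.2 hy) (hadj C hC) ▸ hMS hy.snd_mem)
  have hinj (C D) (hC : C ∈ O \ {Cu, Cv}) (hD : D ∈ O \ {Cu, Cv}) (h : f C hC = f D hD) :
      C = D := by
    have hxx : x C hC = x D hD :=
      Subtype.ext (hP.1.eq_of_adj_left (hadj C hC) (h ▸ hadj D hD))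
    exact (hx C hC).symm.trans ((congrArg _ hxx).trans (hx D hD))
  have hle : (S \ M.verts).ncard ≤ (O \ {Cu, Cv}).ncard := by
    rw [Set.ncard_sdiff hMS, hM.ncard_verts_s14, hMk,
      Set.ncard_sdiff (Set.pair_subset (s := O) hoddu hoddv),
      Set.ncard_pair hne]
    omega
  obtain ⟨C, hC, rfl⟩ := Set.surj_on_of_inj_on_of_ncard_le f hfM hinj hle (Set.toFinite _) w ⟨hwS, hwM⟩
  have hxC : (Ge G u v S).connectedComponentMk (x C hC) = C := hx C hC
  refine ⟨x C hC, (x C hC).2, (hadj C hC).adj_sub, ?_, ?_, ?_⟩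
  · rw [Subtype.coe_eta, hxC]
    exact hC.1
  · rw [Subtype.coe_eta, hxC]
    exact fun h ↦ hC.2 (.inl h)
  · rw [Subtype.coe_eta, hxC]
    exact fun h ↦ hC.2 (.inr h)
end
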